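/- arXiv:2408.05675 — 3 statements merged into one kernel-verified Lean document; each statement's English description precedes it below -/
import Mathlib

section
/- Let n ≥ 1, α ∈ (0,1), m > 0, R > 0, and let g : ℝⁿ → [0,∞) be measurable and bounded on bounded sets. Suppose E_m ⊆ B_R is a measurable set with |E_m| = m and finite energy that minimizes 𝓔 among all measurable sets of volume m, and that the minimizer is unique up to null sets (i.e., any measurable F ⊆ B_R with |F| = m and 𝓔(F) = 𝓔(E_m) satisfies |F Δ E_m| = 0). Then for every ε > 0 there exists w > 0 such that for every measurable E ⊆ B_R with |E| = m and |𝓔(E) − 𝓔(E_m)| < w, one has |E Δ E_m| / |E_m| < ε. -/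
open MeasureTheory Metric Set
open scoped ENNReal

/-- The fractional (nonlocal) perimeter `P_α(E) = ∫_E ∫_{Eᶜ} |x-y|^{-(n+α)} dy dx`. -/
noncomputable def fracPerimeter (n : ℕ) (α : ℝ) (E : Set (EuclideanSpace ℝ (Fin n))) : ℝ≥0∞ :=
  ∫⁻ x in E, ∫⁻ y in Eᶜ, ENNReal.ofReal (‖x - y‖ ^ (-((n : ℝ) + α)))

/-- The nonlocal free energy `𝓔(E) = P_α(E) + ∫_E g`. -/
noncomputable def freeEnergy (n : ℕ) (α : ℝ) (g : EuclideanSpace ℝ (Fin n) → ℝ)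
    (E : Set (EuclideanSpace ℝ (Fin n))) : ℝ≥0∞ :=
  fracPerimeter n α E + ∫⁻ x in E, ENNReal.ofReal (g x)


open Filter Topology
/-- The half-open grid cube of side `s⁻¹` with corner `z / s`. -/
def gridCube (n : ℕ) (s : ℝ) (z : Fin n → ℤ) : Set (EuclideanSpace ℝ (Fin n)) :=
  {x | ∀ i, ⌊s * x i⌋ = z i}

theorem measurableSet_gridCube (n : ℕ) (s : ℝ) (z : Fin n → ℤ) :
    MeasurableSet (gridCube n s z) := by
  have h : gridCube n s z = ⋂ i, {x | ⌊s * x i⌋ = z i} := by ext; simp [gridCube]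
  rw [h]
  refine MeasurableSet.iInter fun i => ?_
  have : Measurable fun x : EuclideanSpace ℝ (Fin n) => ⌊s * x i⌋ :=
    Int.measurable_floor.comp (by fun_prop)
  exact this (measurableSet_singleton _)

theorem iUnion_gridCube (n : ℕ) (s : ℝ) : ⋃ z, gridCube n s z = univ :=
  eq_univ_of_forall fun x => mem_iUnion.2 ⟨fun i => ⌊s * x i⌋, fun _ => rfl⟩

theorem pairwise_disjoint_gridCube (n : ℕ) (s : ℝ) :
    Pairwise (Function.onFun Disjoint (gridCube n s)) := fun _ _ hzw =>
  Set.disjoint_left.2 fun _ hx hy => hzw (funext fun i => (hx i).symm.trans (hy i))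

theorem volume_gridCube (n : ℕ) {s : ℝ} (hs : 0 < s) (z : Fin n → ℤ) :
    volume (gridCube n s z) = ENNReal.ofReal (s⁻¹ ^ n) := by
  have h : gridCube n s z = (MeasurableEquiv.toLp 2 (Fin n → ℝ)).symm ⁻¹'
      (Set.pi univ fun i => Ico ((z i : ℝ) / s) ((z i + 1) / s)) := by
    ext x
    simp only [gridCube, mem_ofPred_eq, mem_preimage, Set.mem_pi, mem_univ, true_imp_iff, mem_Ico,
      Int.floor_eq_iff]
    refine forall_congr' fun i => ?_
    rw [div_le_iff₀' hs, lt_div_iff₀' hs]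
    rfl
  rw [h, (EuclideanSpace.volume_preserving_symm_measurableEquiv_toLp (Fin n)).measure_preimage
    (MeasurableSet.univ_pi fun i => measurableSet_Ico).nullMeasurableSet, Real.volume_pi_Ico]
  have : ∀ i, ((z i : ℝ) + 1) / s - z i / s = s⁻¹ := fun i => by field_simp; ring
  simp only [this, Finset.prod_const, Finset.card_univ, Fintype.card_fin,
    ENNReal.ofReal_pow (inv_nonneg.2 hs.le)]

theorem norm_sub_le_of_mem_gridCube {n : ℕ} {s : ℝ} (hs : 0 < s) {z : Fin n → ℤ}
    {x y : EuclideanSpace ℝ (Fin n)} (hx : x ∈ gridCube n s z) (hy : y ∈ gridCube n s z) :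
    ‖x - y‖ ≤ √n / s := by
  have key : ∀ i, |x i - y i| ≤ s⁻¹ := fun i => by
    have h1 := Int.abs_sub_lt_one_of_floor_eq_floor ((hx i).trans (hy i).symm)
    rw [← mul_sub, abs_mul, abs_of_pos hs] at h1
    rw [← one_div, le_div_iff₀' hs]
    exact h1.le
  rw [EuclideanSpace.norm_eq, ← Real.sqrt_sq hs.le, ← Real.sqrt_div (by positivity)]
  refine Real.sqrt_le_sqrt ?_
  calc ∑ i, ‖(x - y) i‖ ^ 2 ≤ ∑ i : Fin n, s⁻¹ ^ 2 := by
        refine Finset.sum_le_sum fun i _ => ?_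
        gcongr
        exact key i
    _ = n / s ^ 2 := by simp [div_eq_mul_inv]

theorem one_le_mul_kernel {n : ℕ} {α s : ℝ} (hα : 0 < α) (hs : 0 < s) {z : Fin n → ℤ}
    {x y : EuclideanSpace ℝ (Fin n)} (hx : x ∈ gridCube n s z) (hy : y ∈ gridCube n s z)
    (hxy : x ≠ y) :
    1 ≤ ENNReal.ofReal ((√n / s) ^ ((n : ℝ) + α)) *
      ENNReal.ofReal (‖x - y‖ ^ (-((n : ℝ) + α))) := by
  have h0 : 0 < ‖x - y‖ := norm_pos_iff.2 (sub_ne_zero.2 hxy)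
  have h1 := norm_sub_le_of_mem_gridCube hs hx hy
  have h2 : 0 < ‖x - y‖ ^ ((n : ℝ) + α) := Real.rpow_pos_of_pos h0 _
  rw [← ENNReal.ofReal_mul (by positivity), ENNReal.one_le_ofReal, Real.rpow_neg h0.le,
    ← div_eq_mul_inv, one_le_div h2]
  exact Real.rpow_le_rpow h0.le h1 (by positivity)

/-- A fractional Poincaré inequality on a grid cube. -/
theorem volume_mul_volume_gridCube_le {n : ℕ} {α s : ℝ} (hα : 0 < α) (hs : 0 < s)
    (z : Fin n → ℤ) {E : Set (EuclideanSpace ℝ (Fin n))} (hE : MeasurableSet E) :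
    volume (E ∩ gridCube n s z) * volume (gridCube n s z \ E) ≤
      ENNReal.ofReal ((√n / s) ^ ((n : ℝ) + α)) *
        ∫⁻ x in E ∩ gridCube n s z, ∫⁻ y in Eᶜ, ENNReal.ofReal (‖x - y‖ ^ (-((n : ℝ) + α))) := by
  have hQ := measurableSet_gridCube n s z
  set c := ENNReal.ofReal ((√n / s) ^ ((n : ℝ) + α))
  have hc : c ≠ ⊤ := ENNReal.ofReal_ne_top
  rw [← lintegral_const_mul' _ _ hc, mul_comm, ← setLIntegral_const]
  refine setLIntegral_mono' (hE.inter hQ) fun x hx => ?_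
  calc volume (gridCube n s z \ E) = ∫⁻ _ in gridCube n s z \ E, 1 := by simp
    _ ≤ ∫⁻ y in gridCube n s z \ E, c * ENNReal.ofReal (‖x - y‖ ^ (-((n : ℝ) + α))) :=
        setLIntegral_mono' (hQ.diff hE) fun y hy =>
          one_le_mul_kernel hα hs hx.2 hy.1 fun h => hy.2 (h ▸ hx.1)
    _ ≤ ∫⁻ y in Eᶜ, c * ENNReal.ofReal (‖x - y‖ ^ (-((n : ℝ) + α))) :=
        lintegral_mono_set fun y hy => hy.2
    _ = _ := lintegral_const_mul' _ _ hc

theorem ENNReal.le_two_mul_inv_mul_add_sub {a b c d q : ℝ≥0∞} (hq0 : q ≠ 0) (hq : q ≠ ⊤)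
    (hac : a + c = q) (hda : d ≤ a) (hdb : d + b ≤ q) :
    d ≤ 2 * q⁻¹ * (a * c) + (a - b) := by
  have ha : a ≠ ⊤ := ne_top_of_le_ne_top hq (hac ▸ le_self_add)
  have hc : c ≠ ⊤ := ne_top_of_le_ne_top hq (hac ▸ le_add_self)
  have hb : b ≠ ⊤ := ne_top_of_le_ne_top hq (le_add_self.trans hdb)
  have hd : d ≠ ⊤ := ne_top_of_le_ne_top ha hda
  have key : q * d ≤ 2 * (a * c) + q * (a - b) := by
    lift a to NNReal using ha
    lift b to NNReal using hb
    lift c to NNReal using hc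
    lift d to NNReal using hd
    subst hac
    norm_cast at *
    rw [← NNReal.coe_le_coe] at *
    rcases le_total a b with h | h
    · rw [tsub_eq_zero_of_le h]
      push_cast at *
      have : (a : ℝ) ≤ b := h
      have := a.2; have := c.2; have := d.2
      simp only [NNReal.val_eq_coe] at *
      nlinarith
    · push_cast [NNReal.coe_sub h] at *
      have : (b : ℝ) ≤ a := h
      have := a.2; have := c.2; have := d.2; have := b.2
      simp only [NNReal.val_eq_coe] at *
      nlinarith
  calc d = q⁻¹ * (q * d) := by rw [← mul_assoc, ENNReal.inv_mul_cancel hq0 hq, one_mul]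
    _ ≤ q⁻¹ * (2 * (a * c) + q * (a - b)) := by gcongr
    _ = 2 * q⁻¹ * (a * c) + (q⁻¹ * q) * (a - b) := by ring
    _ = _ := by rw [ENNReal.inv_mul_cancel hq0 hq, one_mul]

theorem volume_eq_tsum_gridCube {n : ℕ} (s : ℝ) {A : Set (EuclideanSpace ℝ (Fin n))}
    (hA : MeasurableSet A) : volume A = ∑' z, volume (A ∩ gridCube n s z) := by
  rw [← measure_iUnion
    (fun z w h => (pairwise_disjoint_gridCube n s h).mono inter_subset_right inter_subset_right)
    (fun z => hA.inter (measurableSet_gridCube n s z)), ← inter_iUnion, iUnion_gridCube, inter_univ]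

/-- Two sets differ little when one has finite perimeter and their masses in the cubes of a fine
grid almost agree. -/
theorem volume_diff_le_fracPerimeter_add_tsum {n : ℕ} {α s : ℝ} (hα : 0 < α) (hs : 0 < s)
    {E F : Set (EuclideanSpace ℝ (Fin n))} (hE : MeasurableSet E) (hF : MeasurableSet F) :
    volume (E \ F) ≤ 2 * ENNReal.ofReal (√n ^ ((n : ℝ) + α) * s ^ (-α)) * fracPerimeter n α E +
      ∑' z, (volume (E ∩ gridCube n s z) - volume (F ∩ gridCube n s z)) := by
  have hpos : 0 < s⁻¹ ^ n := by positivity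
  have hcoef : (ENNReal.ofReal (s⁻¹ ^ n))⁻¹ * ENNReal.ofReal ((√n / s) ^ ((n : ℝ) + α)) =
      ENNReal.ofReal (√n ^ ((n : ℝ) + α) * s ^ (-α)) := by
    rw [← ENNReal.ofReal_inv_of_pos hpos, ← ENNReal.ofReal_mul (by positivity),
      Real.div_rpow (by positivity) hs.le, Real.rpow_add hs, Real.rpow_neg hs.le, Real.rpow_natCast]
    congr 1
    rw [inv_pow, inv_inv]
    field_simp
  have hper : ∑' z, ∫⁻ x in E ∩ gridCube n s z, ∫⁻ y in Eᶜ,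
      ENNReal.ofReal (‖x - y‖ ^ (-((n : ℝ) + α))) = fracPerimeter n α E := by
    rw [← lintegral_iUnion (fun z => hE.inter (measurableSet_gridCube n s z))
      (fun z w h => (pairwise_disjoint_gridCube n s h).mono inter_subset_right inter_subset_right),
      ← inter_iUnion, iUnion_gridCube, inter_univ, fracPerimeter]
  rw [volume_eq_tsum_gridCube s (hE.diff hF), ← hper, ← ENNReal.tsum_mul_left, ← ENNReal.tsum_add]
  refine ENNReal.tsum_le_tsum fun z => ?_
  have hQ := measurableSet_gridCube n s z
  have hq := volume_gridCube n hs z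
  refine (ENNReal.le_two_mul_inv_mul_add_sub (q := volume (gridCube n s z))
    (a := volume (E ∩ gridCube n s z)) (b := volume (F ∩ gridCube n s z))
    (c := volume (gridCube n s z \ E)) (by rw [hq]; exact (ENNReal.ofReal_pos.2 hpos).ne')
    (by simp [hq]) ?_
    (measure_mono (inter_subset_inter_left _ sdiff_subset)) ?_).trans ?_
  · rw [inter_comm, measure_inter_add_sdiff _ hE]
  · rw [← measure_union _ (hF.inter hQ)]
    · exact measure_mono (union_subset inter_subset_right inter_subset_right)
    · exact Set.disjoint_left.2 fun x hx hy => hx.1.2 hy.1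
  · refine add_le_add ?_ le_rfl
    rw [hq, ← hcoef, mul_assoc 2, mul_assoc 2, mul_assoc (ENNReal.ofReal (s⁻¹ ^ n))⁻¹]
    exact mul_le_mul_right (mul_le_mul_right (volume_mul_volume_gridCube_le hα hs z hE) _) _

/-- Sets of bounded fractional perimeter inside a fixed set of finite volume are precompact
in measure. -/
theorem exists_subseq_tendsto_volume_diff {n : ℕ} {α : ℝ} (hα : 0 < α)
    {E : ℕ → Set (EuclideanSpace ℝ (Fin n))} (hE : ∀ k, MeasurableSet (E k))
    {B : Set (EuclideanSpace ℝ (Fin n))} (hB : MeasurableSet B) (hBfin : volume B ≠ ⊤)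
    (hEB : ∀ k, E k ⊆ B) {C : ℝ≥0∞} (hC : C ≠ ⊤) (hper : ∀ k, fracPerimeter n α (E k) ≤ C) :
    ∃ φ : ℕ → ℕ, StrictMono φ ∧
      Tendsto (fun p : ℕ × ℕ => volume (E (φ p.1) \ E (φ p.2))) (atTop ×ˢ atTop) (𝓝 0) := by
  obtain ⟨a, φ, hφ, ha⟩ := CompactSpace.tendsto_subseq
    (fun k (i : ℕ × (Fin n → ℤ)) => volume (E k ∩ gridCube n ((i.1 : ℝ) + 1) i.2))
  refine ⟨φ, hφ, ?_⟩
  rw [tendsto_pi_nhds] at ha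
  have hlim : ∀ N : ℕ, Tendsto (fun p : ℕ × ℕ => ∑' z,
      (volume (E (φ p.1) ∩ gridCube n ((N : ℝ) + 1) z) -
        volume (E (φ p.2) ∩ gridCube n ((N : ℝ) + 1) z))) (atTop ×ˢ atTop) (𝓝 0) := by
    intro N
    simp_rw [← lintegral_count]
    rw [← lintegral_zero (μ := Measure.count) (α := Fin n → ℤ)]
    refine tendsto_lintegral_filter_of_dominated_convergence
      (fun z => volume (B ∩ gridCube n ((N : ℝ) + 1) z))
      (Eventually.of_forall fun _ => measurable_of_countable _)
      (Eventually.of_forall fun p => Eventually.of_forall fun z => ?_) ?_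
      (Eventually.of_forall fun z => ?_)
    · exact tsub_le_self.trans (measure_mono (inter_subset_inter_left _ (hEB _)))
    · rwa [lintegral_count, ← volume_eq_tsum_gridCube _ hB]
    · have hz := ha (N, z)
      have hfin : a (N, z) ≠ ⊤ := ne_top_of_le_ne_top hBfin <| le_of_tendsto hz <|
        Eventually.of_forall fun k => measure_mono (inter_subset_left.trans (hEB _))
      have := ENNReal.Tendsto.sub (hz.comp tendsto_fst) (hz.comp tendsto_snd) (Or.inl hfin)
      rwa [tsub_self] at this
  have hcoef : Tendsto (fun N : ℕ => 2 * ENNReal.ofReal (√n ^ ((n : ℝ) + α) *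
      ((N : ℝ) + 1) ^ (-α)) * C) atTop (𝓝 0) := by
    have h1 : Tendsto (fun N : ℕ => √n ^ ((n : ℝ) + α) * ((N : ℝ) + 1) ^ (-α)) atTop (𝓝 0) := by
      have := ((tendsto_rpow_neg_atTop hα).comp (tendsto_atTop_add_const_right _ (1 : ℝ)
        tendsto_natCast_atTop_atTop)).const_mul (√n ^ ((n : ℝ) + α))
      rwa [mul_zero] at this
    have h2 := ENNReal.tendsto_ofReal h1
    rw [ENNReal.ofReal_zero] at h2
    have h3 := ENNReal.Tendsto.mul_const (ENNReal.Tendsto.const_mul (a := 2) h2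
      (Or.inr (by simp))) (Or.inr hC)
    simpa using h3
  rw [ENNReal.tendsto_nhds_zero]
  intro η hη
  have hη2 : 0 < η / 2 := ENNReal.half_pos hη.ne'
  obtain ⟨N, hN⟩ := ((ENNReal.tendsto_nhds_zero.1 hcoef) _ hη2).exists
  filter_upwards [(ENNReal.tendsto_nhds_zero.1 (hlim N)) _ hη2] with p hp
  calc volume (E (φ p.1) \ E (φ p.2)) ≤ _ :=
        volume_diff_le_fracPerimeter_add_tsum hα (by positivity : (0 : ℝ) < N + 1) (hE _) (hE _)
    _ ≤ η / 2 + η / 2 := add_le_add (le_trans (by gcongr; exact hper _) hN) hp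
    _ = η := ENNReal.add_halves η

/-- A sequence of sets which is Cauchy in measure has a subsequence converging almost
everywhere. -/
theorem exists_subseq_ae_eventually_mem_iff {X : Type*} [MeasurableSpace X] {μ : Measure X}
    {E : ℕ → Set X}
    (hE : Tendsto (fun p : ℕ × ℕ => μ (E p.1 \ E p.2)) (atTop ×ˢ atTop) (𝓝 0)) :
    ∃ φ : ℕ → ℕ, StrictMono φ ∧
      ∀ᵐ x ∂μ, ∀ᶠ j in atTop, x ∈ E (φ j) ↔ x ∈ {x | ∀ᶠ i in atTop, x ∈ E (φ i)} := by
  obtain ⟨δ, hδ, hsum⟩ := ENNReal.exists_pos_sum_of_countable' (one_ne_zero (α := ℝ≥0∞)) ℕ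
  have hev : ∀ i, ∃ M, ∀ k ≥ M, ∀ l ≥ k, μ (E k \ E l) ≤ δ i ∧ μ (E l \ E k) ≤ δ i := by
    intro i
    have := (ENNReal.tendsto_nhds_zero.1 hE) _ (hδ i)
    rw [prod_atTop_atTop_eq, eventually_atTop] at this
    obtain ⟨⟨M, M'⟩, h⟩ := this
    refine ⟨max M M', fun k hk l hl => ⟨h (k, l) ⟨?_, ?_⟩, h (l, k) ⟨?_, ?_⟩⟩⟩ <;>
      simp only <;> omega
  obtain ⟨φ, hφ, h⟩ := extraction_forall_of_eventually' hev
  have hmono : ∀ i, φ i ≤ φ (i + 1) := fun i => (hφ i.lt_succ_self).le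
  refine ⟨φ, hφ, ?_⟩
  have h1 := ae_eventually_notMem (μ := μ) (s := fun i => E (φ i) \ E (φ (i + 1)))
    (ne_top_of_le_ne_top (hsum.trans ENNReal.one_lt_top).ne
      (ENNReal.tsum_le_tsum fun i => (h i _ (hmono i)).1))
  have h2 := ae_eventually_notMem (μ := μ) (s := fun i => E (φ (i + 1)) \ E (φ i))
    (ne_top_of_le_ne_top (hsum.trans ENNReal.one_lt_top).ne
      (ENNReal.tsum_le_tsum fun i => (h i _ (hmono i)).2))
  filter_upwards [h1, h2] with x hx1 hx2
  obtain ⟨M, hM⟩ := eventually_atTop.1 (hx1.and hx2)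
  have hstep : ∀ i ≥ M, (x ∈ E (φ i) ↔ x ∈ E (φ M)) := by
    intro i hi
    induction i, hi using Nat.le_induction with
    | base => rfl
    | succ i hi ih =>
      have := hM i hi
      simp only [Set.mem_sdiff] at this
      rw [← ih]
      tauto
  filter_upwards [eventually_ge_atTop M] with j hj
  rw [hstep j hj]
  constructor
  · intro hx
    filter_upwards [eventually_ge_atTop M] with i hi using (hstep i hi).2 hx
  · intro hx
    obtain ⟨i, hi, hiM⟩ := (hx.and (eventually_ge_atTop M)).exists
    exact (hstep i hiM).1 hi

/-- Lower semicontinuity of the free energy under almost everywhere convergence of sets. -/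
theorem freeEnergy_le_liminf {n : ℕ} {α : ℝ} {g : EuclideanSpace ℝ (Fin n) → ℝ}
    (hg : Measurable g) {E : ℕ → Set (EuclideanSpace ℝ (Fin n))}
    (hE : ∀ k, MeasurableSet (E k)) {F : Set (EuclideanSpace ℝ (Fin n))} (hF : MeasurableSet F)
    (hlim : ∀ᵐ x, ∀ᶠ j in atTop, x ∈ E j ↔ x ∈ F) :
    freeEnergy n α g F ≤ liminf (fun j => freeEnergy n α g (E j)) atTop := by
  set K : EuclideanSpace ℝ (Fin n) → EuclideanSpace ℝ (Fin n) → ℝ≥0∞ :=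
    fun x y => ENNReal.ofReal (‖x - y‖ ^ (-((n : ℝ) + α)))
  have hK : Measurable (Function.uncurry K) := by
    simp only [K, Function.uncurry_def]; fun_prop
  have hG : Measurable fun x => ENNReal.ofReal (g x) := hg.ennreal_ofReal
  have hinner : ∀ A : Set (EuclideanSpace ℝ (Fin n)), Measurable fun x => ∫⁻ y in A, K x y :=
    fun A => hK.lintegral_prod_right'
  have hrw : ∀ A : Set (EuclideanSpace ℝ (Fin n)), MeasurableSet A → freeEnergy n α g A =
      ∫⁻ x, A.indicator (fun x => (∫⁻ y in Aᶜ, K x y) + ENNReal.ofReal (g x)) x := by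
    intro A hA
    rw [lintegral_indicator hA, lintegral_add_left (hinner _)]
    rfl
  have hlsc : ∀ x, ∫⁻ y in Fᶜ, K x y ≤ liminf (fun j => ∫⁻ y in (E j)ᶜ, K x y) atTop := by
    intro x
    have hKx : Measurable (K x) := hK.of_uncurry_left
    calc ∫⁻ y in Fᶜ, K x y = ∫⁻ y, Fᶜ.indicator (K x) y := (lintegral_indicator hF.compl _).symm
      _ ≤ ∫⁻ y, liminf (fun j => (E j)ᶜ.indicator (K x) y) atTop := by
          refine lintegral_mono_ae ?_
          filter_upwards [hlim] with y hy
          refine le_liminf_of_le (f := atTop) (a := Fᶜ.indicator (K x) y) (by isBoundedDefault) ?_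
          filter_upwards [hy] with j hj
          by_cases h : y ∈ F <;> simp [h, hj]
      _ ≤ liminf (fun j => ∫⁻ y, (E j)ᶜ.indicator (K x) y) atTop :=
          lintegral_liminf_le fun j => hKx.indicator (hE j).compl
      _ = _ := by simp_rw [lintegral_indicator (hE _).compl]
  rw [hrw F hF]
  simp_rw [fun j => hrw (E j) (hE j)]
  refine le_trans (lintegral_mono_ae ?_)
    (lintegral_liminf_le fun j => ((hinner _).add hG).indicator (hE j))
  filter_upwards [hlim] with x hx
  by_cases hxF : x ∈ F
  · rw [indicator_of_mem hxF]
    calc (∫⁻ y in Fᶜ, K x y) + ENNReal.ofReal (g x)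
        ≤ liminf (fun j => ∫⁻ y in (E j)ᶜ, K x y) atTop + ENNReal.ofReal (g x) := by
          gcongr; exact hlsc x
      _ = liminf (fun j => (∫⁻ y in (E j)ᶜ, K x y) + ENNReal.ofReal (g x)) atTop :=
          (liminf_add_const _ _ _ (by isBoundedDefault) (by isBoundedDefault)).symm
      _ = _ := by
          refine liminf_congr ?_
          filter_upwards [hx] with j hj
          rw [indicator_of_mem (hj.2 hxF)]
  · simp [indicator_of_notMem hxF]

/-- Existence of a stability modulus: if the minimizer in `B_R` is unique up to null sets,
then sets of volume `m` in `B_R` with almost minimal energy are close to the minimizer. -/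
theorem stmt_9 (n : ℕ) (hn : 1 ≤ n) (α : ℝ) (hα : α ∈ Set.Ioo (0 : ℝ) 1)
    (m R : ℝ) (hm : 0 < m) (hR : 0 < R)
    (g : EuclideanSpace ℝ (Fin n) → ℝ) (hgmeas : Measurable g) (hg0 : ∀ x, 0 ≤ g x)
    (hgbdd : ∀ ρ : ℝ, 0 < ρ → ∃ C : ℝ, ∀ x ∈ ball (0 : EuclideanSpace ℝ (Fin n)) ρ, g x ≤ C)
    (Em : Set (EuclideanSpace ℝ (Fin n))) (hEmmeas : MeasurableSet Em)
    (hEmR : Em ⊆ ball (0 : EuclideanSpace ℝ (Fin n)) R)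
    (hEmvol : volume Em = ENNReal.ofReal m)
    (hEmfin : freeEnergy n α g Em ≠ ⊤)
    (hEmmin : ∀ F : Set (EuclideanSpace ℝ (Fin n)), MeasurableSet F →
      volume F = ENNReal.ofReal m → freeEnergy n α g Em ≤ freeEnergy n α g F)
    (huniq : ∀ F : Set (EuclideanSpace ℝ (Fin n)), MeasurableSet F →
      F ⊆ ball (0 : EuclideanSpace ℝ (Fin n)) R → volume F = ENNReal.ofReal m →
      freeEnergy n α g F = freeEnergy n α g Em → volume (symmDiff F Em) = 0) :
    ∀ ε : ℝ, 0 < ε → ∃ w : ℝ, 0 < w ∧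
      ∀ E : Set (EuclideanSpace ℝ (Fin n)), MeasurableSet E →
        E ⊆ ball (0 : EuclideanSpace ℝ (Fin n)) R → volume E = ENNReal.ofReal m →
        freeEnergy n α g E - freeEnergy n α g Em < ENNReal.ofReal w →
        volume (symmDiff E Em) / volume Em < ENNReal.ofReal ε := by
  intro ε hε
  by_contra! hcon
  have hw : ∀ k : ℕ, (0 : ℝ) < 1 / ((k : ℝ) + 1) := fun k => by positivity
  choose E hE hER hEvol hEen hEbad using fun k : ℕ => hcon _ (hw k)
  have hBfin : volume (ball (0 : EuclideanSpace ℝ (Fin n)) R) ≠ ⊤ := measure_ball_lt_top.ne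
  have hen : ∀ k, freeEnergy n α g (E k) ≤
      freeEnergy n α g Em + ENNReal.ofReal (1 / ((k : ℝ) + 1)) := fun k =>
    tsub_le_iff_left.1 (hEen k).le
  have hper : ∀ k, fracPerimeter n α (E k) ≤ freeEnergy n α g Em + ENNReal.ofReal 1 := by
    intro k
    refine (le_self_add.trans (hen k)).trans ?_
    gcongr
    rw [div_le_one (by positivity)]
    linarith [(Nat.cast_nonneg k : (0 : ℝ) ≤ k)]
  obtain ⟨φ, hφ, hcauchy⟩ := exists_subseq_tendsto_volume_diff hα.1 hE measurableSet_ball hBfin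
    hER (by finiteness) hper
  obtain ⟨ψ, hψ, hlim⟩ := exists_subseq_ae_eventually_mem_iff
    (E := fun k => E (φ k)) hcauchy
  set F : Set (EuclideanSpace ℝ (Fin n)) := {x | ∀ᶠ i in atTop, x ∈ E (φ (ψ i))} with hFdef
  have hF : MeasurableSet F := by
    have : F = liminf (fun i => E (φ (ψ i))) atTop := by
      ext x
      simp [hFdef, mem_liminf_iff_eventually_mem]
    rw [this]
    exact MeasurableSet.measurableSet_liminf fun i => hE _
  have hFR : F ⊆ ball 0 R := fun x hx => by
    obtain ⟨i, hi⟩ := Eventually.exists hx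
    exact hER _ hi
  have hFvol : volume F = ENNReal.ofReal m := by
    have := tendsto_measure_of_ae_tendsto_indicator atTop hF (fun i => hE (φ (ψ i)))
      measurableSet_ball hBfin (Eventually.of_forall fun i => hER _) hlim
    simp_rw [hEvol] at this
    exact (tendsto_nhds_unique this tendsto_const_nhds)
  have hFle : freeEnergy n α g F ≤ freeEnergy n α g Em := by
    refine (freeEnergy_le_liminf hgmeas (fun i => hE (φ (ψ i))) hF hlim).trans ?_
    have h0 : Tendsto (fun k : ℕ => freeEnergy n α g Em + ENNReal.ofReal (1 / ((k : ℝ) + 1)))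
        atTop (𝓝 (freeEnergy n α g Em)) := by
      have := (ENNReal.tendsto_ofReal tendsto_one_div_add_atTop_nhds_zero_nat).const_add
        (freeEnergy n α g Em)
      simpa using this
    rw [← (h0.comp (hφ.comp hψ).tendsto_atTop).liminf_eq]
    exact liminf_le_liminf (Eventually.of_forall fun i => hen _)
  have hnull := huniq F hF hFR hFvol (hFle.antisymm (hEmmin F hF hFvol))
  have hsymm : Tendsto (fun i => volume (symmDiff (E (φ (ψ i))) Em)) atTop (𝓝 0) := by
    rw [← hnull]
    refine tendsto_measure_of_ae_tendsto_indicator atTop (hF.symmDiff hEmmeas)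
      (fun i => (hE _).symmDiff hEmmeas) measurableSet_ball hBfin
      (Eventually.of_forall fun i => symmDiff_subset_union.trans (union_subset (hER _) hEmR)) ?_
    filter_upwards [hlim] with x hx
    filter_upwards [hx] with i hi
    simp only [mem_symmDiff, hi]
  have hquot := ENNReal.Tendsto.div_const hsymm (b := volume Em)
    (Or.inr (by rw [hEmvol]; simpa using hm))
  rw [ENNReal.zero_div] at hquot
  exact (ENNReal.ofReal_pos.2 hε).not_ge
    (ge_of_tendsto hquot (Eventually.of_forall fun i => hEbad _))
end

section
/- Let n ≥ 2, α ∈ (0,1), m > 0, and let g : ℝⁿ → [0,∞) be measurable. Let ρ = (m/|B_1|)^{1/n}, so |B_ρ| = m, and set S = sup_{B_ρ} g, assumed finite. If E_m is a measurable set with |E_m| = m and finite energy that minimizes 𝓔 among measurable sets of volume m, then P_α(E_m) − P_α(B_ρ) ≤ S·m; equivalently, with γ = (|B_1|/m)^{1/n}, one has P_α(γ E_m) − P_α(B_1) ≤ |B_1|^{(n−α)/n} · S · m^{α/n}. -/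
open MeasureTheory Metric Set
open scoped ENNReal

/-- Change of variables for a dilation in a Lebesgue integral over a measurable set. -/
theorem setLIntegral_image_smul {n : ℕ} {c : ℝ} (hc : 0 < c)
    {E : Set (EuclideanSpace ℝ (Fin n))} (hE : MeasurableSet E)
    (f : EuclideanSpace ℝ (Fin n) → ℝ≥0∞) :
    ∫⁻ x in (fun x => c • x) '' E, f x = ENNReal.ofReal (c ^ n) * ∫⁻ x in E, f (c • x) := by
  have hderiv : ∀ x ∈ E, HasFDerivWithinAt (fun x : EuclideanSpace ℝ (Fin n) => c • x)
      (c • ContinuousLinearMap.id ℝ (EuclideanSpace ℝ (Fin n))) E x := fun x _ =>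
    ((hasFDerivAt_id x).const_smul c).hasFDerivWithinAt
  have hinj : InjOn (fun x : EuclideanSpace ℝ (Fin n) => c • x) E :=
    (smul_right_injective _ hc.ne').injOn
  have hdet : |(c • ContinuousLinearMap.id ℝ (EuclideanSpace ℝ (Fin n))).det| = c ^ n := by
    simp [ContinuousLinearMap.det, abs_of_pos hc]
  rw [lintegral_image_eq_lintegral_abs_det_fderiv_mul volume hE hderiv hinj, hdet,
    lintegral_const_mul' _ _ ENNReal.ofReal_ne_top]

/-- The fractional perimeter is homogeneous of degree `n - α` under dilations. -/
theorem fracPerimeter_image_smul {n : ℕ} (α : ℝ) {c : ℝ} (hc : 0 < c)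
    {E : Set (EuclideanSpace ℝ (Fin n))} (hE : MeasurableSet E) :
    fracPerimeter n α ((fun x => c • x) '' E)
      = ENNReal.ofReal (c ^ ((n : ℝ) - α)) * fracPerimeter n α E := by
  have hbij : Function.Bijective (fun x : EuclideanSpace ℝ (Fin n) => c • x) :=
    MulAction.bijective₀ hc.ne'
  have hker : ∀ x y : EuclideanSpace ℝ (Fin n),
      ENNReal.ofReal (‖c • x - c • y‖ ^ (-((n : ℝ) + α)))
        = ENNReal.ofReal (c ^ (-((n : ℝ) + α))) * ENNReal.ofReal (‖x - y‖ ^ (-((n : ℝ) + α))) := by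
    intro x y
    rw [← smul_sub, norm_smul, Real.norm_of_nonneg hc.le, Real.mul_rpow hc.le (norm_nonneg _),
      ENNReal.ofReal_mul (by positivity)]
  unfold fracPerimeter
  simp_rw [← image_compl_eq hbij, setLIntegral_image_smul hc hE.compl,
    setLIntegral_image_smul hc hE, hker]
  simp_rw [lintegral_const_mul' _ _ ENNReal.ofReal_ne_top, ← mul_assoc]
  congr 1
  rw [← ENNReal.ofReal_mul (by positivity), ← ENNReal.ofReal_mul (by positivity)]
  congr 1
  rw [← Real.rpow_natCast, ← Real.rpow_add hc, ← Real.rpow_add hc]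
  ring_nf

/-- If `E` has free energy at most that of `F`, and the potential is at most `S` on `F`, then the
perimeter of `E` exceeds that of `F` by at most `S * |F|`. -/
theorem fracPerimeter_sub_le_of_le_freeEnergy {n : ℕ} {α : ℝ}
    {g : EuclideanSpace ℝ (Fin n) → ℝ} {E F : Set (EuclideanSpace ℝ (Fin n))}
    (h : freeEnergy n α g E ≤ freeEnergy n α g F) {S : ℝ} (hF : MeasurableSet F)
    (hS : ∀ x ∈ F, g x ≤ S) :
    fracPerimeter n α E - fracPerimeter n α F ≤ ENNReal.ofReal S * volume F := by
  rw [tsub_le_iff_left]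
  calc fracPerimeter n α E ≤ freeEnergy n α g E := le_self_add
    _ ≤ freeEnergy n α g F := h
    _ ≤ _ := by
      unfold freeEnergy
      gcongr
      calc ∫⁻ x in F, ENNReal.ofReal (g x) ≤ ∫⁻ _ in F, ENNReal.ofReal S :=
            setLIntegral_mono' hF fun x hx => ENNReal.ofReal_le_ofReal (hS x hx)
        _ = _ := setLIntegral_const _ _

/-- The fractional isoperimetric deficit of a minimizer is controlled by `S·m`, and,
after rescaling to unit volume, by `|B_1|^{(n-α)/n} S m^{α/n}`. -/
theorem stmt_13 (n : ℕ) (hn : 2 ≤ n) (α : ℝ) (hα : α ∈ Set.Ioo (0 : ℝ) 1)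
    (m : ℝ) (hm : 0 < m)
    (g : EuclideanSpace ℝ (Fin n) → ℝ) (hgmeas : Measurable g) (hg0 : ∀ x, 0 ≤ g x)
    (ρ : ℝ) (hρ : ρ = (m / (volume (ball (0 : EuclideanSpace ℝ (Fin n)) 1)).toReal)
      ^ ((1 : ℝ) / n))
    (S : ℝ) (hS : IsLUB (g '' ball (0 : EuclideanSpace ℝ (Fin n)) ρ) S)
    (Em : Set (EuclideanSpace ℝ (Fin n))) (hEmmeas : MeasurableSet Em)
    (hEmvol : volume Em = ENNReal.ofReal m)
    (hEmfin : freeEnergy n α g Em ≠ ⊤)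
    (hEmmin : ∀ F : Set (EuclideanSpace ℝ (Fin n)), MeasurableSet F →
      volume F = ENNReal.ofReal m → freeEnergy n α g Em ≤ freeEnergy n α g F) :
    fracPerimeter n α Em - fracPerimeter n α (ball (0 : EuclideanSpace ℝ (Fin n)) ρ)
      ≤ ENNReal.ofReal (S * m) ∧
    fracPerimeter n α
        ((fun x => (((volume (ball (0 : EuclideanSpace ℝ (Fin n)) 1)).toReal / m)
            ^ ((1 : ℝ) / n)) • x) '' Em)
      - fracPerimeter n α (ball (0 : EuclideanSpace ℝ (Fin n)) 1)
      ≤ (volume (ball (0 : EuclideanSpace ℝ (Fin n)) 1)) ^ (((n : ℝ) - α) / n)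
          * ENNReal.ofReal S * (ENNReal.ofReal m) ^ (α / n) := by
  have hn0 : (n : ℝ) ≠ 0 := by positivity
  set ω : ℝ := (volume (ball (0 : EuclideanSpace ℝ (Fin n)) 1)).toReal
  have hωtop : volume (ball (0 : EuclideanSpace ℝ (Fin n)) 1) ≠ ⊤ := measure_ball_lt_top.ne
  have hωpos : 0 < ω := ENNReal.toReal_pos (measure_ball_pos _ _ one_pos).ne' hωtop
  have hωeq : volume (ball (0 : EuclideanSpace ℝ (Fin n)) 1) = ENNReal.ofReal ω :=
    (ENNReal.ofReal_toReal hωtop).symm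
  have hρpos : 0 < ρ := by rw [hρ]; positivity
  have hρn : ρ ^ n = m / ω := by
    rw [hρ, one_div, Real.rpow_inv_natCast_pow (by positivity) (by omega)]
  have hvol : volume (ball (0 : EuclideanSpace ℝ (Fin n)) ρ) = ENNReal.ofReal m := by
    rw [Measure.addHaar_ball_of_pos _ _ hρpos, finrank_euclideanSpace_fin, hρn, hωeq,
      ← ENNReal.ofReal_mul (by positivity), div_mul_cancel₀ _ hωpos.ne']
  have hgS : ∀ x ∈ ball (0 : EuclideanSpace ℝ (Fin n)) ρ, g x ≤ S := fun x hx =>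
    hS.1 (mem_image_of_mem g hx)
  have hS0 : 0 ≤ S := (hg0 0).trans (hgS 0 (mem_ball_self hρpos))
  have hdef : fracPerimeter n α Em - fracPerimeter n α (ball (0 : EuclideanSpace ℝ (Fin n)) ρ)
      ≤ ENNReal.ofReal (S * m) := by
    rw [ENNReal.ofReal_mul hS0, ← hvol]
    exact fracPerimeter_sub_le_of_le_freeEnergy (hEmmin _ measurableSet_ball hvol)
      measurableSet_ball hgS
  refine ⟨hdef, ?_⟩
  set γ : ℝ := (ω / m) ^ ((1 : ℝ) / n) with hγ
  have hγpos : 0 < γ := by positivity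
  have hγρ : γ * ρ = 1 := by
    rw [hγ, hρ, ← Real.mul_rpow (by positivity) (by positivity),
      div_mul_div_cancel₀ hm.ne', div_self hωpos.ne', Real.one_rpow]
  have hball : ball (0 : EuclideanSpace ℝ (Fin n)) 1 = (fun x => γ • x) '' ball 0 ρ := by
    rw [image_smul, _root_.smul_ball hγpos.ne', smul_zero, Real.norm_of_nonneg hγpos.le, hγρ]
  have hconst : γ ^ ((n : ℝ) - α) * (S * m) = ω ^ (((n : ℝ) - α) / n) * S * m ^ (α / n) := by
    have hexp : α / n = 1 - ((n : ℝ) - α) / n := by field_simp; ring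
    rw [hγ, ← Real.rpow_mul (by positivity), one_div_mul_eq_div,
      Real.div_rpow hωpos.le hm.le, hexp, Real.rpow_sub hm, Real.rpow_one]
    ring
  rw [hωeq, ENNReal.ofReal_rpow_of_pos hωpos, ENNReal.ofReal_rpow_of_pos hm,
    ← ENNReal.ofReal_mul (by positivity), ← ENNReal.ofReal_mul (by positivity), ← hconst,
    ENNReal.ofReal_mul (by positivity), hball, fracPerimeter_image_smul α hγpos hEmmeas,
    fracPerimeter_image_smul α hγpos measurableSet_ball,
    ← ENNReal.mul_sub fun _ _ => ENNReal.ofReal_ne_top]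
  gcongr
end

section
/- Let n ≥ 1 and α ∈ (0,1). If (E_k) is a sequence of measurable subsets of ℝⁿ and E is a measurable set with |E_k Δ E| → 0 as k → ∞, then P_α(E) ≤ liminf_{k→∞} P_α(E_k); i.e., the fractional perimeter is lower semicontinuous with respect to L¹ convergence of characteristic functions. -/
open MeasureTheory Metric Set Filter
open scoped ENNReal Topology

/-- If the measures of `E k ∆ F` are summable, then for almost every point, membership in `E k`
eventually agrees with membership in `F`. -/
theorem ae_eventually_mem_iff_of_tsum_measure_symmDiff_ne_top {X : Type*} [MeasurableSpace X]
    {μ : Measure X} {E : ℕ → Set X} {F : Set X}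
    (h : ∑' k, μ (symmDiff (E k) F) ≠ ∞) :
    ∀ᵐ x ∂μ, ∀ᶠ k in atTop, (x ∈ E k ↔ x ∈ F) := by
  filter_upwards [ae_eventually_notMem h] with x hx
  filter_upwards [hx] with k hk
  rw [Set.mem_symmDiff] at hk
  tauto

/-- Fatou's lemma for nonnegative functions restricted to pointwise converging sets. -/
theorem setLIntegral_le_liminf_of_ae_eventually_mem_iff {X : Type*} [MeasurableSpace X]
    {μ : Measure X} {f : ℕ → X → ℝ≥0∞} {g : X → ℝ≥0∞} (hf : ∀ k, Measurable (f k))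
    {E : ℕ → Set X} {F : Set X} (hE : ∀ k, MeasurableSet (E k)) (hF : MeasurableSet F)
    (hEF : ∀ᵐ x ∂μ, ∀ᶠ k in atTop, (x ∈ E k ↔ x ∈ F))
    (hg : ∀ x, g x ≤ liminf (fun k => f k x) atTop) :
    ∫⁻ x in F, g x ∂μ ≤ liminf (fun k => ∫⁻ x in E k, f k x ∂μ) atTop := by
  simp_rw [← lintegral_indicator hF, ← lintegral_indicator (hE _)]
  refine le_trans (lintegral_mono_ae ?_)
    (lintegral_liminf_le fun k => (hf k).indicator (hE k))
  filter_upwards [hEF] with x hx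
  by_cases hxF : x ∈ F
  · rw [indicator_of_mem hxF]
    refine (hg x).trans (liminf_congr ?_).le
    filter_upwards [hx] with k hk
    rw [indicator_of_mem (hk.2 hxF)]
  · simp [indicator_of_notMem hxF]

/-- Lower semicontinuity of a nonlocal interaction energy along pointwise a.e. convergence of
sets. -/
theorem lintegral_lintegral_compl_le_liminf {X : Type*} [MeasurableSpace X]
    {μ : Measure X} [SFinite μ] {K : X → X → ℝ≥0∞} (hK : Measurable (Function.uncurry K))
    {E : ℕ → Set X} {F : Set X} (hE : ∀ k, MeasurableSet (E k)) (hF : MeasurableSet F)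
    (hEF : ∀ᵐ x ∂μ, ∀ᶠ k in atTop, (x ∈ E k ↔ x ∈ F)) :
    ∫⁻ x in F, ∫⁻ y in Fᶜ, K x y ∂μ ∂μ ≤
      liminf (fun k => ∫⁻ x in E k, ∫⁻ y in (E k)ᶜ, K x y ∂μ ∂μ) atTop := by
  refine setLIntegral_le_liminf_of_ae_eventually_mem_iff (fun k => hK.lintegral_prod_right')
    hE hF hEF fun x => ?_
  refine setLIntegral_le_liminf_of_ae_eventually_mem_iff (f := fun _ => K x)
    (fun _ => hK.comp measurable_prodMk_left) (fun k => (hE k).compl) hF.compl ?_ fun y => by simp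
  filter_upwards [hEF] with y hy
  filter_upwards [hy] with k hk
  exact not_congr hk

/-- Lower semicontinuity of the fractional perimeter with respect to `L¹` convergence of
characteristic functions. -/
theorem stmt_18 (n : ℕ) (hn : 1 ≤ n) (α : ℝ) (hα : α ∈ Set.Ioo (0 : ℝ) 1)
    (E : ℕ → Set (EuclideanSpace ℝ (Fin n))) (hEmeas : ∀ k, MeasurableSet (E k))
    (F : Set (EuclideanSpace ℝ (Fin n))) (hFmeas : MeasurableSet F)
    (hconv : Tendsto (fun k => volume (symmDiff (E k) F)) atTop (𝓝 0)) :
    fracPerimeter n α F ≤ Filter.liminf (fun k => fracPerimeter n α (E k)) atTop := by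
  by_contra! hlt
  obtain ⟨c, hc, hcF⟩ := exists_between hlt
  have hfreq : ∃ᶠ k in atTop, fracPerimeter n α (E k) < c :=
    frequently_lt_of_liminf_lt (by isBoundedDefault) hc
  obtain ⟨ε, hε, hεsum⟩ := ENNReal.exists_pos_sum_of_countable' one_ne_zero ℕ
  obtain ⟨φ, -, hφ⟩ := extraction_forall_of_frequently fun j =>
    hfreq.and_eventually (hconv.eventually_lt_const (hε j))
  have hsum : ∑' j, volume (symmDiff (E (φ j)) F) ≠ ∞ :=
    ((ENNReal.tsum_le_tsum fun j => (hφ j).2.le).trans_lt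
      (hεsum.trans ENNReal.one_lt_top)).ne
  have hle : fracPerimeter n α F ≤ liminf (fun j => fracPerimeter n α (E (φ j))) atTop :=
    lintegral_lintegral_compl_le_liminf (by unfold Function.uncurry; fun_prop)
      (fun j => hEmeas (φ j)) hFmeas
      (ae_eventually_mem_iff_of_tsum_measure_symmDiff_ne_top hsum)
  have hlec : liminf (fun j => fracPerimeter n α (E (φ j))) atTop ≤ c :=
    (liminf_le_liminf (Eventually.of_forall fun j => (hφ j).1.le)).trans (liminf_const c).le
  exact (hle.trans hlec).not_gt hcF
end
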